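/- arXiv:1709.08895 — 6 statements merged into one kernel-verified Lean document; each statement's English description precedes it below -/
import Mathlib

section
/- Let a ≥ 0 and let M : [a,∞) → (0,∞) be a non-decreasing function. Then M has positive increase if and only if there exists λ > 1 such that liminf_{s→∞} M(λs)/M(s) > 1. -/
open Filter Topology

/-- `M : [a, ∞) → (0, ∞)` has positive increase: there are `α > 0`, `c ∈ (0,1]` and
`s₀ ≥ a` with `s₀ > 0` such that `M (λ s) / M s ≥ c λ^α` for all `λ ≥ 1`, `s ≥ s₀`. -/
def HasPosIncrease (a : ℝ) (M : ℝ → ℝ) : Prop :=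
  ∃ α : ℝ, 0 < α ∧ ∃ c : ℝ, c ∈ Set.Ioc (0 : ℝ) 1 ∧ ∃ s₀ : ℝ, a ≤ s₀ ∧ 0 < s₀ ∧
    ∀ lam : ℝ, 1 ≤ lam → ∀ s : ℝ, s₀ ≤ s → c * lam ^ α ≤ M (lam * s) / M s

/-- Iterating `q * M s ≤ M (lam * s)`, valid for `s ≥ s₀`, multiplies `M` by powers of `q`. -/
theorem pow_mul_le_of_mul_le_comp_mul {M : ℝ → ℝ} {lam q s₀ s : ℝ} (hlam : 1 ≤ lam)
    (hq : 0 ≤ q) (hs₀ : 0 ≤ s₀) (h : ∀ t, s₀ ≤ t → q * M t ≤ M (lam * t)) (hs : s₀ ≤ s) (n : ℕ) :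
    q ^ n * M s ≤ M (lam ^ n * s) := by
  induction n with
  | zero => simp
  | succ n ih =>
    have hle : s₀ ≤ lam ^ n * s :=
      hs.trans (le_mul_of_one_le_left (hs₀.trans hs) (one_le_pow₀ hlam))
    calc q ^ (n + 1) * M s = q * (q ^ n * M s) := by ring
      _ ≤ q * M (lam ^ n * s) := by gcongr
      _ ≤ M (lam * (lam ^ n * s)) := h _ hle
      _ = M (lam ^ (n + 1) * s) := by ring_nf

/-- Let `a ≥ 0` and let `M : [a,∞) → (0,∞)` be non-decreasing. Then `M`
has positive increase if and only if there exists `λ > 1` with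
`liminf_{s → ∞} M (λ s) / M s > 1` (the liminf being taken in the extended reals). -/
theorem positive_increase_iff_liminf (a : ℝ) (ha : 0 ≤ a) (M : ℝ → ℝ)
    (hMpos : ∀ s : ℝ, a ≤ s → 0 < M s)
    (hMmono : ∀ s t : ℝ, a ≤ s → s ≤ t → M s ≤ M t) :
    HasPosIncrease a M ↔
      ∃ lam : ℝ, 1 < lam ∧
        (1 : EReal) <
          Filter.liminf (fun s : ℝ => ((M (lam * s) / M s : ℝ) : EReal)) Filter.atTop := by
  constructor
  · rintro ⟨α, hα, c, ⟨hc0, hc1⟩, s₀, -, -, h⟩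
    have hbase : 1 < 2 / c := by rw [lt_div_iff₀ hc0]; linarith
    have hlam : 1 < (2 / c) ^ α⁻¹ := Real.one_lt_rpow hbase (inv_pos.2 hα)
    refine ⟨(2 / c) ^ α⁻¹, hlam, ?_⟩
    have hcl : c * ((2 / c) ^ α⁻¹) ^ α = 2 := by
      rw [Real.rpow_inv_rpow (by positivity) hα.ne']
      field_simp
    refine lt_of_lt_of_le (b := ((2 : ℝ) : EReal)) (by exact_mod_cast one_lt_two) ?_
    refine le_liminf_of_le (by isBoundedDefault) ?_
    filter_upwards [eventually_ge_atTop s₀] with s hs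
    exact EReal.coe_le_coe_iff.2 (hcl.ge.trans (h _ hlam.le s hs))
  · rintro ⟨lam, hlam, h⟩
    obtain ⟨q, hq1, hq⟩ := EReal.lt_iff_exists_real_btwn.1 h
    replace hq1 : 1 < q := by exact_mod_cast hq1
    obtain ⟨s₁, hs₁⟩ := eventually_atTop.1 (eventually_lt_of_lt_liminf hq)
    have hstep : ∀ s, max s₁ (max a 1) ≤ s → q * M s ≤ M (lam * s) := by
      intro s hs
      simp only [max_le_iff] at hs
      have := EReal.coe_lt_coe_iff.1 (hs₁ s hs.1)
      exact ((lt_div_iff₀ (hMpos s hs.2.1)).1 this).le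
    have hpos : 0 < max s₁ (max a 1) := by simp
    have hq0 : 0 < q := by linarith
    have hlog : 0 < Real.log lam := Real.log_pos hlam
    have hα : 0 < Real.log q / Real.log lam := div_pos (Real.log_pos hq1) hlog
    refine ⟨Real.log q / Real.log lam, hα, q⁻¹,
      ⟨inv_pos.2 hq0, inv_le_one_of_one_le₀ hq1.le⟩, max s₁ (max a 1), by simp, hpos, ?_⟩
    intro mu hmu s hs
    have has : a ≤ s := le_trans (by simp) hs
    have hs0 : 0 < s := hpos.trans_le hs
    obtain ⟨n, hn, hn'⟩ := exists_nat_pow_near hmu hlam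
    have hlamq : lam ^ (Real.log q / Real.log lam) = q := by
      rw [Real.rpow_def_of_pos (by linarith), mul_div_cancel₀ _ hlog.ne', Real.exp_log hq0]
    have hmuq : mu ^ (Real.log q / Real.log lam) ≤ q ^ (n + 1) := by
      calc mu ^ (Real.log q / Real.log lam)
          ≤ (lam ^ (n + 1)) ^ (Real.log q / Real.log lam) :=
            Real.rpow_le_rpow (by linarith) hn'.le hα.le
        _ = q ^ (n + 1) := by
            rw [← Real.rpow_pow_comm (by linarith), hlamq]
    rw [le_div_iff₀ (hMpos s has)]
    have hlow : s ≤ lam ^ n * s := le_mul_of_one_le_left hs0.le (one_le_pow₀ hlam.le)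
    calc q⁻¹ * mu ^ (Real.log q / Real.log lam) * M s
        ≤ q⁻¹ * q ^ (n + 1) * M s := by
          have := (hMpos s has).le
          gcongr
      _ = q ^ n * M s := by rw [pow_succ', inv_mul_cancel_left₀ hq0.ne']
      _ ≤ M (lam ^ n * s) := pow_mul_le_of_mul_le_comp_mul hlam.le hq0.le hpos.le hstep hs n
      _ ≤ M (mu * s) := hMmono _ _ (has.trans hlow) (by gcongr)
end

section
/- Let a ≥ 0 and let M : [a,∞) → (0,∞) be a continuous non-decreasing function with M(s) → ∞ as s → ∞. If M has positive increase, then for every c > 0 one has M⁻¹(t) ≍ M⁻¹(ct) as t → ∞ (i.e. each is bounded above by a constant multiple of the other for all sufficiently large t). Conversely, if M⁻¹(t) ≍ M⁻¹(ct) as t → ∞ for some strictly positive c ≠ 1, then M has positive increase (and hence the asymptotic comparability holds for all c > 0). -/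
open Filter Topology

/-- The right-continuous right-inverse `M⁻¹ t = sup {r ≥ a : M r ≤ t}` of a
continuous non-decreasing function `M` on `[a, ∞)` with `M s → ∞` as `s → ∞`. -/
noncomputable def rcInv (a : ℝ) (M : ℝ → ℝ) (t : ℝ) : ℝ :=
  sSup {r : ℝ | a ≤ r ∧ M r ≤ t}

/-- `f ≍ g` as `t → ∞`: each is bounded above by a constant multiple of the other
for all sufficiently large `t`. -/
def AsympComparable (f g : ℝ → ℝ) : Prop :=
  ∃ C₁ : ℝ, 0 < C₁ ∧ ∃ C₂ : ℝ, 0 < C₂ ∧ ∃ t₀ : ℝ, ∀ t : ℝ, t₀ ≤ t →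
    f t ≤ C₁ * g t ∧ g t ≤ C₂ * f t

/-- Every point of a sublevel set of `M` lies below the right-inverse. -/
theorem le_rcInv {a : ℝ} {M : ℝ → ℝ} (hMtop : Tendsto M atTop atTop) {r t : ℝ}
    (hr : a ≤ r) (h : M r ≤ t) : r ≤ rcInv a M t := by
  refine le_csSup ?_ ⟨hr, h⟩
  obtain ⟨b, hb⟩ := eventually_atTop.1 (hMtop.eventually_gt_atTop t)
  refine ⟨b, fun x hx => ?_⟩
  by_contra! hxb
  exact absurd hx.2 (not_le.2 (hb x hxb.le))

/-- The right-inverse takes values in `[a, ∞)` and is a right-inverse of `M`. -/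
theorem rcInv_spec {a : ℝ} {M : ℝ → ℝ}
    (hMmono : ∀ s t : ℝ, a ≤ s → s ≤ t → M s ≤ M t)
    (hMcont : ContinuousOn M (Set.Ici a))
    (hMtop : Tendsto M atTop atTop) {t : ℝ} (ht : M a ≤ t) :
    a ≤ rcInv a M t ∧ M (rcInv a M t) = t := by
  have hbdd : BddAbove {r : ℝ | a ≤ r ∧ M r ≤ t} :=
    ⟨rcInv a M t, fun r hr => le_rcInv hMtop hr.1 hr.2⟩
  have hclosed : IsClosed {r : ℝ | a ≤ r ∧ M r ≤ t} :=
    hMcont.preimage_isClosed_of_isClosed isClosed_Ici (isClosed_Iic (a := t))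
  have hmem : a ≤ rcInv a M t ∧ M (rcInv a M t) ≤ t :=
    hclosed.csSup_mem ⟨a, le_rfl, ht⟩ hbdd
  refine ⟨hmem.1, hmem.2.antisymm ?_⟩
  obtain ⟨b, hb, hab⟩ := ((hMtop.eventually_ge_atTop t).and (eventually_ge_atTop a)).exists
  obtain ⟨r, hr, rfl⟩ := intermediate_value_Icc hab
    (hMcont.mono Set.Icc_subset_Ici_self) ⟨ht, hb⟩
  exact hMmono _ _ hr.1 (le_rcInv hMtop hr.1 le_rfl)

/-- Positive increase bounds `M⁻¹ (c t)` by a multiple of `M⁻¹ t`. -/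
theorem HasPosIncrease.exists_rcInv_mul_le {a : ℝ} {M : ℝ → ℝ}
    (hMpos : ∀ s : ℝ, a ≤ s → 0 < M s)
    (hMmono : ∀ s t : ℝ, a ≤ s → s ≤ t → M s ≤ M t)
    (hMcont : ContinuousOn M (Set.Ici a))
    (hMtop : Tendsto M atTop atTop) (h : HasPosIncrease a M) {c : ℝ} (hc : 0 < c) :
    ∃ C : ℝ, 0 < C ∧ ∃ t₀ : ℝ, ∀ t : ℝ, t₀ ≤ t → rcInv a M (c * t) ≤ C * rcInv a M t := by
  obtain ⟨α, hα, k, ⟨hk, -⟩, s₀, has, hs₀, H⟩ := h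
  obtain ⟨lam, hlam, hlam1⟩ :=
    (((tendsto_rpow_atTop hα).eventually_gt_atTop (c / k)).and (eventually_ge_atTop 1)).exists
  refine ⟨lam, by linarith, max (M s₀) (M a / c), fun t ht => ?_⟩
  have hst : M s₀ ≤ t := (le_max_left _ _).trans ht
  have hct : M a ≤ c * t := (div_le_iff₀' hc).1 ((le_max_right _ _).trans ht)
  have hs : s₀ ≤ rcInv a M t := le_rcInv hMtop has hst
  have ht0 : 0 < t := (hMpos s₀ has).trans_le hst
  obtain ⟨hat, hMt⟩ := rcInv_spec hMmono hMcont hMtop ((hMmono a s₀ le_rfl has).trans hst)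
  obtain ⟨-, hMct⟩ := rcInv_spec hMmono hMcont hMtop hct
  by_contra! hlt
  have h1 := H lam hlam1 _ hs
  rw [hMt, le_div_iff₀ ht0] at h1
  have h2 : M (lam * rcInv a M t) ≤ c * t := by
    rw [← hMct]
    exact hMmono _ _ (hat.trans (le_mul_of_one_le_left (hs₀.le.trans hs) hlam1)) hlt.le
  have h3 : c < k * lam ^ α := (div_lt_iff₀' hk).1 hlam
  nlinarith

/-- Positive increase makes the dilates of `M⁻¹` comparable to it. -/
theorem HasPosIncrease.asympComparable_rcInv {a : ℝ} {M : ℝ → ℝ}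
    (hMpos : ∀ s : ℝ, a ≤ s → 0 < M s)
    (hMmono : ∀ s t : ℝ, a ≤ s → s ≤ t → M s ≤ M t)
    (hMcont : ContinuousOn M (Set.Ici a))
    (hMtop : Tendsto M atTop atTop) (h : HasPosIncrease a M) {c : ℝ} (hc : 0 < c) :
    AsympComparable (fun t => rcInv a M t) (fun t => rcInv a M (c * t)) := by
  obtain ⟨C₁, hC₁, t₁, h₁⟩ :=
    h.exists_rcInv_mul_le hMpos hMmono hMcont hMtop (inv_pos.2 hc)
  obtain ⟨C₂, hC₂, t₂, h₂⟩ := h.exists_rcInv_mul_le hMpos hMmono hMcont hMtop hc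
  refine ⟨C₁, hC₁, C₂, hC₂, max (t₁ / c) t₂, fun t ht => ⟨?_, h₂ t ((le_max_right _ _).trans ht)⟩⟩
  have := h₁ (c * t) ((div_le_iff₀' hc).1 ((le_max_left _ _).trans ht))
  rwa [inv_mul_cancel_left₀ hc.ne'] at this

/-- Iterating `L * M s ≤ M (C * s)` yields positive increase. -/
theorem hasPosIncrease_of_mul_le {a : ℝ} {M : ℝ → ℝ}
    (hMpos : ∀ s : ℝ, a ≤ s → 0 < M s)
    (hMmono : ∀ s t : ℝ, a ≤ s → s ≤ t → M s ≤ M t)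
    {L C s₀ : ℝ} (hL : 1 < L) (hC : 1 < C) (has : a ≤ s₀) (hs₀ : 0 < s₀)
    (H : ∀ s : ℝ, s₀ ≤ s → L * M s ≤ M (C * s)) : HasPosIncrease a M := by
  have hL0 : 0 < L := by linarith
  have hC0 : 0 < C := by linarith
  have hge : ∀ (n : ℕ) {s : ℝ}, s₀ ≤ s → s₀ ≤ C ^ n * s := fun n s hs =>
    hs.trans (le_mul_of_one_le_left (hs₀.le.trans hs) (one_le_pow₀ hC.le))
  have hiter : ∀ (n : ℕ) {s : ℝ}, s₀ ≤ s → L ^ n * M s ≤ M (C ^ n * s) := by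
    intro n s hs
    induction n with
    | zero => simp
    | succ n ih =>
      calc L ^ (n + 1) * M s = L * (L ^ n * M s) := by ring
        _ ≤ L * M (C ^ n * s) := by gcongr
        _ ≤ M (C * (C ^ n * s)) := H _ (hge n hs)
        _ = M (C ^ (n + 1) * s) := by rw [pow_succ', mul_assoc]
  have hα : 0 < Real.logb C L := Real.logb_pos hC hL
  refine ⟨Real.logb C L, hα, L⁻¹, ⟨inv_pos.2 hL0, inv_le_one_of_one_le₀ hL.le⟩,
    s₀, has, hs₀, fun lam hlam s hs => ?_⟩
  obtain ⟨n, hn, hn'⟩ := exists_nat_pow_near hlam hC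
  have hpow : lam ^ Real.logb C L ≤ L ^ (n + 1) := by
    calc lam ^ Real.logb C L ≤ (C ^ (n + 1)) ^ Real.logb C L := by gcongr
      _ = (C ^ Real.logb C L) ^ (n + 1) := (Real.rpow_pow_comm hC0.le _ _).symm
      _ = L ^ (n + 1) := by rw [Real.rpow_logb hC0 hC.ne' hL0]
  rw [le_div_iff₀ (hMpos s (has.trans hs))]
  have hMs := hMpos s (has.trans hs)
  calc L⁻¹ * lam ^ Real.logb C L * M s ≤ L⁻¹ * L ^ (n + 1) * M s := by gcongr
    _ = L ^ n * M s := by rw [pow_succ', inv_mul_cancel_left₀ hL0.ne']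
    _ ≤ M (C ^ n * s) := hiter n hs
    _ ≤ M (lam * s) := hMmono _ _ (has.trans (hge n hs)) (by
      have := hs₀.le.trans hs
      gcongr)

/-- If `M⁻¹ (K t)` is bounded by a multiple of `M⁻¹ t` for some `K > 1`, then `M` has positive
increase. -/
theorem hasPosIncrease_of_rcInv_mul_le {a : ℝ} {M : ℝ → ℝ} (ha : 0 ≤ a)
    (hMpos : ∀ s : ℝ, a ≤ s → 0 < M s)
    (hMmono : ∀ s t : ℝ, a ≤ s → s ≤ t → M s ≤ M t)
    (hMcont : ContinuousOn M (Set.Ici a))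
    (hMtop : Tendsto M atTop atTop) {K C t₀ : ℝ} (hK : 1 < K)
    (H : ∀ t : ℝ, t₀ ≤ t → rcInv a M (K * t) ≤ C * rcInv a M t) : HasPosIncrease a M := by
  have hL : 1 < √K := Real.lt_sqrt_of_sq_lt (by simpa using hK)
  have hL0 : 0 < √K := by linarith
  obtain ⟨b, hb⟩ := eventually_atTop.1 (hMtop.eventually_ge_atTop (√K * max t₀ (M a)))
  refine hasPosIncrease_of_mul_le hMpos hMmono (s₀ := max b (max a 1)) hL
    (lt_max_of_lt_right one_lt_two : 1 < max C 2)
    ((le_max_left _ _).trans (le_max_right _ _))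
    (one_pos.trans_le ((le_max_right _ _).trans (le_max_right _ _))) fun s hs => ?_
  have has : a ≤ s := ((le_max_left _ _).trans (le_max_right _ _)).trans hs
  have hMs : 0 < M s := hMpos s has
  have ht : max t₀ (M a) ≤ M s / √K := (le_div_iff₀' hL0).2 (hb s ((le_max_left _ _).trans hs))
  obtain ⟨hat, hMt⟩ := rcInv_spec hMmono hMcont hMtop ((le_max_right _ _).trans ht)
  have hle : rcInv a M (M s / √K) ≤ s := by
    by_contra! hlt
    have := hMmono _ _ has hlt.le
    rw [hMt] at this
    exact absurd this (not_le.2 (div_lt_self hMs hL))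
  have heq : K * (M s / √K) = √K * M s := by
    rw [← mul_div_assoc, div_eq_iff hL0.ne', mul_right_comm,
      Real.mul_self_sqrt (by linarith)]
  have hLM : M a ≤ √K * M s :=
    (hMmono a s le_rfl has).trans (le_mul_of_one_le_left hMs.le hL.le)
  obtain ⟨haL, hML⟩ := rcInv_spec hMmono hMcont hMtop hLM
  have hbound := H _ ((le_max_left _ _).trans ht)
  rw [heq] at hbound
  rw [← hML]
  refine hMmono _ _ haL (hbound.trans ?_)
  have h0 : 0 ≤ rcInv a M (M s / √K) := ha.trans hat
  calc C * rcInv a M (M s / √K) ≤ max C 2 * rcInv a M (M s / √K) := by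
        gcongr
        exact le_max_left _ _
    _ ≤ max C 2 * s := by gcongr

/-- Let `a ≥ 0` and `M : [a,∞) → (0,∞)` be continuous, non-decreasing
with `M s → ∞`. If `M` has positive increase then `M⁻¹ t ≍ M⁻¹ (c t)` as `t → ∞` for every
`c > 0`; conversely if `M⁻¹ t ≍ M⁻¹ (c t)` as `t → ∞` for some positive `c ≠ 1` then `M`
has positive increase (and hence the comparability holds for all `c > 0`). -/
theorem rcInv_asymp_iff_positive_increase (a : ℝ) (ha : 0 ≤ a) (M : ℝ → ℝ)
    (hMpos : ∀ s : ℝ, a ≤ s → 0 < M s)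
    (hMmono : ∀ s t : ℝ, a ≤ s → s ≤ t → M s ≤ M t)
    (hMcont : ContinuousOn M (Set.Ici a))
    (hMtop : Tendsto M atTop atTop) :
    (HasPosIncrease a M →
      ∀ c : ℝ, 0 < c → AsympComparable (fun t => rcInv a M t) (fun t => rcInv a M (c * t))) ∧
    (∀ c : ℝ, 0 < c → c ≠ 1 →
      AsympComparable (fun t => rcInv a M t) (fun t => rcInv a M (c * t)) →
      HasPosIncrease a M ∧
        ∀ c' : ℝ, 0 < c' →
          AsympComparable (fun t => rcInv a M t) (fun t => rcInv a M (c' * t))) := by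
  refine ⟨fun h c hc => h.asympComparable_rcInv hMpos hMmono hMcont hMtop hc,
    fun c hc hc1 hcomp => ?_⟩
  have h : HasPosIncrease a M := by
    obtain ⟨C₁, -, C₂, -, t₀, H⟩ := hcomp
    rcases hc1.lt_or_gt with hlt | hgt
    · refine hasPosIncrease_of_rcInv_mul_le ha hMpos hMmono hMcont hMtop
        ((one_lt_inv₀ hc).2 hlt) (C := C₁) (t₀ := c * t₀) fun t ht => ?_
      have := (H (c⁻¹ * t) ((le_inv_mul_iff₀ hc).2 ht)).1
      simpa only [mul_inv_cancel_left₀ hc.ne'] using this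
    · exact hasPosIncrease_of_rcInv_mul_le ha hMpos hMmono hMcont hMtop hgt
        fun t ht => (H t ht).2
  exact ⟨h, fun c' hc' => h.asympComparable_rcInv hMpos hMmono hMcont hMtop hc'⟩
end

section
/- Let α > 0 and define M : [0,∞) → (0,∞) by M(s) = 1 for 0 ≤ s < e and M(s) = (log s)^α for s ≥ e. Then, for all sufficiently large s, M_max(s) = c_α⁻¹ (log s)^{α+1}, where M_max(s) = max_{1≤λ≤s} M(λ⁻¹s)·log λ and c_α = α^{−α}(1+α)^{1+α}. -/
open Filter Topology

/-- Weighted AM-GM in the form maximizing `y ^ α * x` over `x + y = L`. -/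
lemma rpow_mul_le_of_add_eq {α x y : ℝ} (hα : 0 < α) (hx : 0 ≤ x) (hy : 0 ≤ y) :
    y ^ α * x ≤ (α ^ (-α) * (1 + α) ^ (1 + α))⁻¹ * (x + y) ^ (α + 1) := by
  have h1 : (0 : ℝ) < 1 + α := by linarith
  have hp : 0 ≤ y / α := by positivity
  have key := Real.geom_mean_le_arith_mean2_weighted (w₁ := α / (1 + α)) (w₂ := 1 / (1 + α))
    (by positivity) (by positivity) hp hx (by field_simp; ring)
  have hsum : α / (1 + α) * (y / α) + 1 / (1 + α) * x = (x + y) / (1 + α) := by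
    field_simp
    ring
  rw [hsum] at key
  have hpow := Real.rpow_le_rpow (by positivity) key h1.le
  rw [Real.mul_rpow (by positivity) (by positivity), ← Real.rpow_mul hp, ← Real.rpow_mul hx,
    div_mul_cancel₀ _ h1.ne', div_mul_cancel₀ _ h1.ne', Real.rpow_one,
    Real.div_rpow hy hα.le, Real.div_rpow (by positivity) h1.le] at hpow
  have hαα : 0 < α ^ α := Real.rpow_pos_of_pos hα α
  calc y ^ α * x = α ^ α * (y ^ α / α ^ α * x) := by field_simp
    _ ≤ α ^ α * ((x + y) ^ (1 + α) / (1 + α) ^ (1 + α)) := by gcongr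
    _ = _ := by
      rw [Real.rpow_neg hα.le, mul_inv, inv_inv, add_comm α 1]
      ring

/-- The maximum of `y ^ α * x` over `x + y = L` is attained at `x = L / (1 + α)`. -/
lemma rpow_mul_eq_at_maximizer {α L : ℝ} (hα : 0 < α) (hL : 0 < L) :
    (α * L / (1 + α)) ^ α * (L / (1 + α))
      = (α ^ (-α) * (1 + α) ^ (1 + α))⁻¹ * L ^ (α + 1) := by
  have h1 : (0 : ℝ) < 1 + α := by linarith
  rw [Real.div_rpow (by positivity) h1.le, Real.mul_rpow hα.le hL.le, Real.rpow_neg hα.le,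
    mul_inv, inv_inv, add_comm α 1, Real.rpow_add hL, Real.rpow_add h1, Real.rpow_one,
    Real.rpow_one]
  field_simp

/-- Let `α > 0` and let `M : [0,∞) → (0,∞)` be given by `M s = 1` for
`0 ≤ s < e` and `M s = (log s)^α` for `s ≥ e`. Then for all sufficiently large `s`,
`M_max s = c_α⁻¹ (log s)^(α+1)`, where `M_max s = max_{1 ≤ λ ≤ s} M (λ⁻¹ s) log λ` and
`c_α = α^(-α) (1 + α)^(1 + α)`. -/
theorem statement14 (α : ℝ) (hα : 0 < α) :
    ∃ s₁ : ℝ, ∀ s : ℝ, s₁ ≤ s →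
      (⨆ lam : {l : ℝ // 1 ≤ l ∧ l ≤ s},
          (if (lam : ℝ)⁻¹ * s < Real.exp 1 then 1
            else Real.log ((lam : ℝ)⁻¹ * s) ^ α) * Real.log (lam : ℝ))
        = (α ^ (-α) * (1 + α) ^ (1 + α))⁻¹ * Real.log s ^ (α + 1) := by
  have h1 : (0 : ℝ) < 1 + α := by linarith
  have hc : 0 < α ^ (-α) * (1 + α) ^ (1 + α) := by positivity
  have hev : ∀ᶠ s : ℝ in atTop, 1 ≤ s ∧ (1 + α) / α ≤ Real.log s ∧
      α ^ (-α) * (1 + α) ^ (1 + α) ≤ Real.log s ^ α :=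
    (eventually_ge_atTop 1).and
      ((Real.tendsto_log_atTop.eventually_ge_atTop _).and
        (((tendsto_rpow_atTop hα).comp Real.tendsto_log_atTop).eventually_ge_atTop _))
  obtain ⟨s₁, hs₁⟩ := eventually_atTop.1 hev
  refine ⟨s₁, fun s hs => ?_⟩
  obtain ⟨hs1, hlog, hrpow⟩ := hs₁ s hs
  have hs0 : 0 < s := by linarith
  have hL : 0 < Real.log s := lt_of_lt_of_le (by positivity) hlog
  have : Nonempty {l : ℝ // 1 ≤ l ∧ l ≤ s} := ⟨⟨1, le_rfl, hs1⟩⟩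
  have hub : ∀ lam : {l : ℝ // 1 ≤ l ∧ l ≤ s},
      (if (lam : ℝ)⁻¹ * s < Real.exp 1 then 1
        else Real.log ((lam : ℝ)⁻¹ * s) ^ α) * Real.log (lam : ℝ)
      ≤ (α ^ (-α) * (1 + α) ^ (1 + α))⁻¹ * Real.log s ^ (α + 1) := by
    rintro ⟨l, hl1, hls⟩
    have hl0 : 0 < l := by linarith
    have hx := Real.log_nonneg hl1
    have hle := Real.log_le_log hl0 hls
    dsimp only
    split_ifs with hlt
    · rw [one_mul, Real.rpow_add hL, Real.rpow_one, ← mul_assoc]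
      have hone : 1 ≤ (α ^ (-α) * (1 + α) ^ (1 + α))⁻¹ * Real.log s ^ α := by
        rwa [inv_mul_eq_div, one_le_div hc]
      nlinarith
    · have hlogmul : Real.log (l⁻¹ * s) = Real.log s - Real.log l := by
        rw [Real.log_mul (by positivity) hs0.ne', Real.log_inv]
        ring
      have := rpow_mul_le_of_add_eq hα hx (sub_nonneg.2 hle)
      rwa [add_sub_cancel, ← hlogmul] at this
  refine le_antisymm (ciSup_le hub) ?_
  have hlam1 : 1 ≤ Real.exp (Real.log s / (1 + α)) := Real.one_le_exp (by positivity)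
  have hlams : Real.exp (Real.log s / (1 + α)) ≤ s := by
    rw [← Real.le_log_iff_exp_le hs0]
    exact div_le_self hL.le (by linarith)
  refine le_trans (le_of_eq ?_)
    (le_ciSup ⟨_, Set.forall_mem_range.2 hub⟩ ⟨Real.exp (Real.log s / (1 + α)), hlam1, hlams⟩)
  have hquot : (Real.exp (Real.log s / (1 + α)))⁻¹ * s = Real.exp (α * Real.log s / (1 + α)) := by
    conv_lhs => rw [← Real.exp_log hs0, Real.log_exp]
    rw [← Real.exp_neg, ← Real.exp_add]
    congr 1
    field_simp
    ring
  have hge : 1 ≤ α * Real.log s / (1 + α) := by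
    rw [div_le_iff₀ hα] at hlog
    rw [le_div_iff₀ h1]
    linarith
  dsimp only
  rw [hquot, if_neg (not_lt.2 (Real.exp_le_exp.2 hge)), Real.log_exp, Real.log_exp,
    rpow_mul_eq_at_maximizer hα hL]
end

section
/- Let α ∈ (0,1) and define M : [0,∞) → (0,∞) by M(s) = 1 for 0 ≤ s < 1 and M(s) = exp((log s)^α) for s ≥ 1, and let N(s) = α⁻¹ (log s)^{1−α} for s > 1. Then there exists s₀ > 1 such that M(λs)/M(s) ≥ λ^{1/N(λs)} for all λ ≥ 1 and all s ≥ s₀; that is, M has quasi-positive increase with auxiliary function N and constant c = 1. -/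
open Filter Topology

/-- Tangent-line bound for the concave function `t ↦ t ^ α`, based at the right endpoint. -/
theorem rpow_sub_rpow_ge_of_concave {α x y : ℝ} (h0 : 0 ≤ α) (h1 : α ≤ 1) (hx : 0 ≤ x)
    (hy : 0 < y) : x * (α * (x + y) ^ (α - 1)) ≤ (x + y) ^ α - y ^ α := by
  have ht : 0 < x + y := by linarith
  have hy_eq : y = (x + y) * (1 + -(x / (x + y))) := by field_simp; ring
  have hle : x / (x + y) ≤ 1 := (div_le_one ht).2 (by linarith)
  have bernoulli := rpow_one_add_le_one_add_mul_self
    (s := -(x / (x + y))) (by linarith) h0 h1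
  have key : y ^ α ≤ (x + y) ^ α * (1 + α * -(x / (x + y))) := by
    calc y ^ α = (x + y) ^ α * (1 + -(x / (x + y))) ^ α := by
          rw [← Real.mul_rpow ht.le (by linarith), ← hy_eq]
      _ ≤ _ := mul_le_mul_of_nonneg_left bernoulli (Real.rpow_nonneg ht.le _)
  rw [Real.rpow_sub_one ht.ne']
  have expand : (x + y) ^ α * (1 + α * -(x / (x + y))) =
      (x + y) ^ α - x * (α * ((x + y) ^ α / (x + y))) := by ring
  linarith

/-- Let `α ∈ (0,1)`, let `M : [0,∞) → (0,∞)` be given by `M s = 1` for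
`0 ≤ s < 1` and `M s = exp ((log s)^α)` for `s ≥ 1`, and let `N s = α⁻¹ (log s)^(1-α)` for
`s > 1`. Then there is `s₀ > 1` such that `M (λ s) / M s ≥ λ^(1 / N (λ s))` for all `λ ≥ 1`
and all `s ≥ s₀`; that is, `M` has quasi-positive increase with auxiliary function `N` and
constant `c = 1`. -/
theorem statement15 (α : ℝ) (hα : α ∈ Set.Ioo (0 : ℝ) 1) :
    ∃ s₀ : ℝ, 1 < s₀ ∧ ∀ lam : ℝ, 1 ≤ lam → ∀ s : ℝ, s₀ ≤ s →
      lam ^ (α⁻¹ * Real.log (lam * s) ^ (1 - α))⁻¹ ≤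
        (if lam * s < 1 then 1 else Real.exp (Real.log (lam * s) ^ α)) /
          (if s < 1 then 1 else Real.exp (Real.log s ^ α)) := by
  obtain ⟨h0, h1⟩ := hα
  refine ⟨2, by norm_num, fun lam hlam s hs => ?_⟩
  have hls : 1 ≤ lam * s := by nlinarith
  have hlog : Real.log (lam * s) = Real.log lam + Real.log s :=
    Real.log_mul (by linarith) (by linarith)
  have hx : 0 ≤ Real.log lam := Real.log_nonneg hlam
  have hy : 0 < Real.log s := Real.log_pos (by linarith)
  rw [if_neg (by linarith), if_neg (by linarith), ← Real.exp_sub,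
    Real.rpow_def_of_pos (by linarith), Real.exp_le_exp, hlog, mul_inv, inv_inv,
    ← Real.rpow_neg (by linarith), neg_sub]
  exact rpow_sub_rpow_ge_of_concave h0.le h1.le hx hy
end

section
/- Let α ∈ (0,1) and define M : [0,∞) → (0,∞) by M(s) = 1 for 0 ≤ s < 1 and M(s) = exp((log s)^α) for s ≥ 1, and let N(s) = α⁻¹ (log s)^{1−α} for s > 1. Then M_max(s) ~ e⁻¹·M(s)·N(s) as s → ∞, i.e. M_max(s)/(e⁻¹ M(s) N(s)) → 1 as s → ∞, where M_max(s) = max_{1≤λ≤s} M(λ⁻¹s)·log λ. -/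
open Filter Topology

/-- Tangent-line bound for the concave function `t ↦ t ^ α` at `L`. -/
theorem rpow_sub_le_tangent {α L x : ℝ} (h0 : 0 < α) (h1 : α < 1) (hL : 0 < L) (hx : x ≤ L) :
    (L - x) ^ α ≤ L ^ α - x / (α⁻¹ * L ^ (1 - α)) := by
  have hxL : x / L ≤ 1 := (div_le_one hL).2 hx
  have hb := rpow_one_add_le_one_add_mul_self (s := -(x / L)) (by linarith) h0.le h1.le
  have hfac : L - x = L * (1 + -(x / L)) := by field_simp; ring
  have hpow : L ^ (1 - α) = L / L ^ α := by rw [Real.rpow_sub hL, Real.rpow_one]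
  have hLα : 0 < L ^ α := Real.rpow_pos_of_pos hL α
  rw [hfac, Real.mul_rpow hL.le (by linarith), hpow]
  calc L ^ α * (1 + -(x / L)) ^ α ≤ L ^ α * (1 + α * -(x / L)) := by gcongr
    _ = L ^ α - x / (α⁻¹ * (L / L ^ α)) := by field_simp; ring

theorem mul_exp_neg_div_le {n : ℝ} (hn : 0 < n) (x : ℝ) :
    x * Real.exp (-(x / n)) ≤ n * (Real.exp 1)⁻¹ := by
  have h := Real.add_one_le_exp (x / n - 1)
  have hx : x ≤ n * Real.exp (x / n - 1) := by
    calc x = n * (x / n - 1 + 1) := by field_simp; ring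
      _ ≤ _ := by gcongr
  calc x * Real.exp (-(x / n))
      ≤ n * Real.exp (x / n - 1) * Real.exp (-(x / n)) := by gcongr
    _ = n * (Real.exp 1)⁻¹ := by
      rw [mul_assoc, ← Real.exp_add, ← Real.exp_neg]; congr 2; ring

theorem exp_rpow_sub_mul_le {α L x : ℝ} (h0 : 0 < α) (h1 : α < 1) (hL : 0 < L)
    (hx0 : 0 ≤ x) (hx : x ≤ L) :
    Real.exp ((L - x) ^ α) * x ≤
      (Real.exp 1)⁻¹ * Real.exp (L ^ α) * (α⁻¹ * L ^ (1 - α)) := by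
  have hn : 0 < α⁻¹ * L ^ (1 - α) := by positivity
  calc Real.exp ((L - x) ^ α) * x
      ≤ Real.exp (L ^ α - x / (α⁻¹ * L ^ (1 - α))) * x := by
        gcongr; exact rpow_sub_le_tangent h0 h1 hL hx
    _ = Real.exp (L ^ α) * (x * Real.exp (-(x / (α⁻¹ * L ^ (1 - α))))) := by
        rw [sub_eq_add_neg, Real.exp_add]; ring
    _ ≤ Real.exp (L ^ α) * (α⁻¹ * L ^ (1 - α) * (Real.exp 1)⁻¹) := by
        exact mul_le_mul_of_nonneg_left (mul_exp_neg_div_le hn x) (Real.exp_pos _).le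
    _ = _ := by ring

theorem tendsto_inv_mul_rpow_neg {α : ℝ} (h0 : 0 < α) :
    Tendsto (fun L : ℝ => α⁻¹ * L ^ (-α)) atTop (𝓝 0) := by
  simpa using (tendsto_rpow_neg_atTop h0).const_mul α⁻¹

theorem inv_mul_rpow_one_sub {α L : ℝ} (hL : 0 < L) :
    α⁻¹ * L ^ (1 - α) = L * (α⁻¹ * L ^ (-α)) := by
  rw [sub_eq_add_neg, Real.rpow_add hL, Real.rpow_one]; ring

theorem tendsto_rpow_sub_sub_rpow {α : ℝ} (h0 : 0 < α) :
    Tendsto (fun L : ℝ => (L - α⁻¹ * L ^ (1 - α)) ^ α - L ^ α) atTop (𝓝 (-1)) := by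
  have hd : HasDerivAt (fun u : ℝ => (1 - u) ^ α) (-α) 0 := by
    have h := ((hasDerivAt_id (0 : ℝ)).const_sub 1).rpow_const (p := α) (Or.inl (by simp))
    simpa using h
  have hu : Tendsto (fun L : ℝ => α⁻¹ * L ^ (-α)) atTop (𝓝[≠] 0) := by
    refine tendsto_nhdsWithin_iff.2 ⟨tendsto_inv_mul_rpow_neg h0, ?_⟩
    filter_upwards [eventually_gt_atTop 0] with L hL
    have : 0 < α⁻¹ * L ^ (-α) := by positivity
    exact this.ne'
  have h := ((hasDerivAt_iff_tendsto_slope.1 hd).comp hu).const_mul α⁻¹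
  have hv : α⁻¹ * -α = -1 := by field_simp
  rw [hv] at h
  refine h.congr' ?_
  filter_upwards [eventually_gt_atTop 0,
    (tendsto_inv_mul_rpow_neg h0).eventually_lt_const one_pos] with L hL hu1
  have hLα : 0 < L ^ α := Real.rpow_pos_of_pos hL α
  have hfac : L - α⁻¹ * L ^ (1 - α) = L * (1 - α⁻¹ * L ^ (-α)) := by
    rw [inv_mul_rpow_one_sub hL]; ring
  rw [hfac, Real.mul_rpow hL.le (by linarith)]
  simp only [Function.comp, slope_def_field, sub_zero, Real.one_rpow]
  generalize (1 - α⁻¹ * L ^ (-α)) ^ α = w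
  rw [Real.rpow_neg hL.le]
  field_simp

/-- Let `α ∈ (0,1)`, let `M : [0,∞) → (0,∞)` be given by `M s = 1` for
`0 ≤ s < 1` and `M s = exp ((log s)^α)` for `s ≥ 1`, and let `N s = α⁻¹ (log s)^(1-α)` for
`s > 1`. Then `M_max s ∼ e⁻¹ M s · N s` as `s → ∞`, i.e.
`M_max s / (e⁻¹ M s N s) → 1`, where `M_max s = max_{1 ≤ λ ≤ s} M (λ⁻¹ s) log λ`. -/
theorem statement16 (α : ℝ) (hα : α ∈ Set.Ioo (0 : ℝ) 1) :
    Tendsto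
      (fun s : ℝ =>
        (⨆ lam : {l : ℝ // 1 ≤ l ∧ l ≤ s},
            (if (lam : ℝ)⁻¹ * s < 1 then 1
              else Real.exp (Real.log ((lam : ℝ)⁻¹ * s) ^ α)) * Real.log (lam : ℝ)) /
          ((Real.exp 1)⁻¹ *
            (if s < 1 then 1 else Real.exp (Real.log s ^ α)) *
              (α⁻¹ * Real.log s ^ (1 - α))))
      atTop (𝓝 1) := by
  obtain ⟨h0, h1⟩ := hα
  have hlim : Tendsto (fun s : ℝ => Real.exp
      ((Real.log s - α⁻¹ * Real.log s ^ (1 - α)) ^ α - Real.log s ^ α + 1)) atTop (𝓝 1) := by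
    have h := (((tendsto_rpow_sub_sub_rpow h0).comp Real.tendsto_log_atTop).add_const 1).rexp
    simpa [Function.comp_def] using h
  have hval : ∀ s : ℝ, 1 < s → ∀ lam : {l : ℝ // 1 ≤ l ∧ l ≤ s},
      (if (lam : ℝ)⁻¹ * s < 1 then 1
        else Real.exp (Real.log ((lam : ℝ)⁻¹ * s) ^ α)) * Real.log (lam : ℝ) =
      Real.exp ((Real.log s - Real.log lam) ^ α) * Real.log lam := by
    rintro s hs ⟨l, hl1, hls⟩
    have hl : 0 < l := by linarith
    have hge : ¬ l⁻¹ * s < 1 := by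
      rw [not_lt, inv_mul_eq_div, one_le_div hl]; exact hls
    simp only [if_neg hge]
    rw [inv_mul_eq_div, Real.log_div (by linarith) hl.ne']
  have hle : ∀ s : ℝ, 1 < s → ∀ lam : {l : ℝ // 1 ≤ l ∧ l ≤ s},
      Real.exp ((Real.log s - Real.log lam) ^ α) * Real.log lam ≤
      (Real.exp 1)⁻¹ * Real.exp (Real.log s ^ α) * (α⁻¹ * Real.log s ^ (1 - α)) :=
    fun s hs lam => exp_rpow_sub_mul_le h0 h1 (Real.log_pos hs) (Real.log_nonneg lam.2.1)
      (Real.log_le_log (by linarith [lam.2.1]) lam.2.2)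
  refine tendsto_of_tendsto_of_tendsto_of_le_of_le' hlim tendsto_const_nhds ?_ ?_
  · filter_upwards [eventually_gt_atTop 1, Real.tendsto_log_atTop.eventually
      ((tendsto_inv_mul_rpow_neg h0).eventually_lt_const one_pos)] with s hs hu
    have hL := Real.log_pos hs
    have hn : 0 < α⁻¹ * Real.log s ^ (1 - α) := by positivity
    have hnL : α⁻¹ * Real.log s ^ (1 - α) ≤ Real.log s := by
      rw [inv_mul_rpow_one_sub hL]
      exact mul_le_of_le_one_right hL.le hu.le
    simp only [hval s hs, if_neg (not_lt.2 hs.le)]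
    rw [le_div_iff₀ (by positivity)]
    have hsup := le_ciSup (f := fun lam : {l : ℝ // 1 ≤ l ∧ l ≤ s} =>
        Real.exp ((Real.log s - Real.log lam) ^ α) * Real.log lam)
      ⟨_, Set.forall_mem_range.2 (hle s hs)⟩
      ⟨Real.exp (α⁻¹ * Real.log s ^ (1 - α)), Real.one_le_exp hn.le,
        (Real.le_log_iff_exp_le (by linarith)).1 hnL⟩
    refine le_of_eq_of_le ?_ hsup
    simp only [Real.log_exp]
    rw [← mul_assoc, ← Real.exp_neg, ← Real.exp_add, ← Real.exp_add]
    congr 2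
    ring
  · filter_upwards [eventually_gt_atTop 1] with s hs
    have hL := Real.log_pos hs
    simp only [hval s hs, if_neg (not_lt.2 hs.le)]
    have : Nonempty {l : ℝ // 1 ≤ l ∧ l ≤ s} := ⟨⟨1, le_rfl, hs.le⟩⟩
    exact (div_le_one (by positivity)).2 (ciSup_le (hle s hs))
end

section
/- Let α ∈ (0,2) and let M : [0,∞) → (0,∞) be a measurable function which is regularly varying of index α. Then there exists a positive Radon measure ν on [0,∞) with ν([0,1)) = 0 and ∫_{[0,∞)} τ⁻¹ dν(τ) < ∞ such that the function k : [0,∞) → (0,∞) defined by k(t) = ∫_{[0,∞)} e^{−τt} dν(τ) is integrable on [0,∞) and satisfies Re𝓕k(s) ~ 1/M(s) as s → ∞, where Re𝓕k(s) = ∫_{[0,∞)} τ/(τ² + s²) dν(τ); that is, M(s)·∫_{[0,∞)} τ/(τ²+s²) dν(τ) → 1 as s → ∞. -/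
open Filter Topology MeasureTheory

/-- If a measurable function has increments tending to zero at infinity, then its increments
over steps of length at most one are eventually uniformly bounded. -/
theorem eventually_abs_sub_le_of_increments_tendsto_zero {g : ℝ → ℝ} (hg : Measurable g)
    (h : ∀ u : ℝ, 0 ≤ u → Tendsto (fun x => g (x + u) - g x) atTop (𝓝 0)) :
    ∃ X : ℝ, ∀ x y : ℝ, X ≤ x → x ≤ y → y ≤ x + 1 → |g y - g x| ≤ 2 := by
  set φ : ℝ → ℝ → ℝ := fun x v => min 1 |g (x + v) - g x| with hφ
  have hφ_meas : ∀ x, Measurable (φ x) := fun x =>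
    measurable_const.min (by fun_prop : Measurable fun v => |g (x + v) - g x|)
  have hφ0 : ∀ x v, 0 ≤ φ x v := fun x v => le_min zero_le_one (abs_nonneg _)
  have hφ1 : ∀ x v, φ x v ≤ 1 := fun x v => min_le_left _ _
  have hφ_int : ∀ x a b, IntervalIntegrable (φ x) volume a b := by
    intro x a b
    refine (intervalIntegrable_const (c := (1 : ℝ))).mono_fun
      (hφ_meas x).aestronglyMeasurable (Eventually.of_forall fun v => ?_)
    simp only [Real.norm_eq_abs, abs_one, abs_of_nonneg (hφ0 x v), hφ1 x v]
  have hlim : Tendsto (fun x => ∫ v in (0 : ℝ)..2, φ x v) atTop (𝓝 (∫ v in (0 : ℝ)..2, 0)) := by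
    refine intervalIntegral.tendsto_integral_filter_of_dominated_convergence
      (fun _ => 1) ?_ ?_ ?_ ?_
    · exact Eventually.of_forall fun x => (hφ_meas x).aestronglyMeasurable
    · refine Eventually.of_forall fun x => Eventually.of_forall fun v _ => ?_
      rw [Real.norm_eq_abs, abs_of_nonneg (hφ0 x v)]
      exact hφ1 x v
    · exact intervalIntegrable_const
    · refine Eventually.of_forall fun v hv => ?_
      rw [Set.uIoc_of_le (by norm_num)] at hv
      have := (tendsto_const_nhds (x := (1 : ℝ))).min (h v hv.1.le).abs
      simpa [hφ] using this
  rw [intervalIntegral.integral_zero] at hlim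
  obtain ⟨X, hX⟩ := eventually_atTop.1
    (hlim.eventually (gt_mem_nhds (by norm_num : (0 : ℝ) < 1 / 2)))
  refine ⟨X, fun x y hx hxy hy => ?_⟩
  by_contra! hlt
  have hmono : ∀ z a b : ℝ, 0 ≤ a → a ≤ b → b ≤ 2 →
      ∫ v in a..b, φ z v ≤ ∫ v in (0 : ℝ)..2, φ z v := fun z a b ha hab hb =>
    intervalIntegral.integral_mono_interval ha hab hb
      (Eventually.of_forall (hφ0 z)) (hφ_int z 0 2)
  have h1 := (hmono x 1 2 (by norm_num) (by norm_num) le_rfl).trans_lt (hX x hx)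
  have h2 := (hmono y (1 - (y - x)) (2 - (y - x)) (by linarith) (by linarith)
    (by linarith)).trans_lt (hX y (hx.trans hxy))
  rw [← intervalIntegral.integral_comp_sub_right (φ y) (y - x)] at h2
  have hint : IntervalIntegrable (fun v => φ y (v - (y - x))) volume 1 2 := by
    simpa using (hφ_int y (1 - (y - x)) (2 - (y - x))).comp_sub_right (y - x)
  have h3 : ∫ _ in (1 : ℝ)..2, (1 : ℝ) ≤ ∫ v in (1 : ℝ)..2, (φ x v + φ y (v - (y - x))) := by
    refine intervalIntegral.integral_mono_on (by norm_num) intervalIntegrable_const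
      ((hφ_int x 1 2).add hint) fun v _ => ?_
    have e : y + (v - (y - x)) = x + v := by ring
    simp only [hφ, e]
    have htri : |g y - g x| ≤ |g (x + v) - g x| + |g (x + v) - g y| := by
      rw [abs_sub_comm (g (x + v)) (g y), add_comm]
      exact abs_sub_le _ _ _
    rcases le_total 1 |g (x + v) - g x| with h | h
    · rw [min_eq_left h]
      linarith [hφ0 y (v - (y - x)), le_min (zero_le_one' ℝ) (abs_nonneg (g (x + v) - g y))]
    · rcases le_total 1 |g (x + v) - g y| with h' | h'
      · rw [min_eq_left h']
        linarith [le_min (zero_le_one' ℝ) (abs_nonneg (g (x + v) - g x))]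
      · linarith
  rw [intervalIntegral.integral_add (hφ_int x 1 2) hint, intervalIntegral.integral_const,
    smul_eq_mul] at h3
  linarith

/-- A measurable function whose increments tend to zero at infinity is eventually Lipschitz at
large scales, with arbitrarily small constant. -/
theorem eventually_abs_sub_le_linear {g : ℝ → ℝ} (hg : Measurable g)
    (h : ∀ u : ℝ, 0 ≤ u → Tendsto (fun x => g (x + u) - g x) atTop (𝓝 0)) {δ : ℝ} (hδ : 0 < δ) :
    ∃ X : ℝ, ∀ x y : ℝ, X ≤ x → X ≤ y → |g y - g x| ≤ δ * |y - x| + 2 := by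
  obtain ⟨X₁, hX₁⟩ := eventually_abs_sub_le_of_increments_tendsto_zero hg h
  have habs : Tendsto (fun x => |g (x + 1) - g x|) atTop (𝓝 0) := by
    simpa using (h 1 zero_le_one).abs
  obtain ⟨X₂, hX₂⟩ := eventually_atTop.1 (habs.eventually (gt_mem_nhds hδ))
  have key : ∀ n : ℕ, ∀ x y : ℝ, max X₁ X₂ ≤ x → x + n ≤ y → y ≤ x + n + 1 →
      |g y - g x| ≤ δ * n + 2 := by
    intro n
    induction n with
    | zero =>
      intro x y hx hxy hy
      simpa using hX₁ x y ((le_max_left _ _).trans hx) (by simpa using hxy) (by simpa using hy)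
    | succ n ih =>
      intro x y hx hxy hy
      push_cast at *
      have h1 := ih (x + 1) y (by linarith) (by linarith) (by linarith)
      have h2 := hX₂ x ((le_max_right _ _).trans hx)
      have h3 := abs_sub_le (g y) (g (x + 1)) (g x)
      linarith
  have ordered : ∀ x y : ℝ, max X₁ X₂ ≤ x → x ≤ y → |g y - g x| ≤ δ * |y - x| + 2 := by
    intro x y hx hxy
    have h0 : 0 ≤ y - x := sub_nonneg.2 hxy
    have h1 := Nat.floor_le h0
    have h2 := Nat.lt_floor_add_one (y - x)
    have h3 := key ⌊y - x⌋₊ x y hx (by linarith) (by linarith)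
    rw [abs_of_nonneg h0]
    nlinarith
  refine ⟨max X₁ X₂, fun x y hx hy => ?_⟩
  rcases le_total x y with hxy | hxy
  · exact ordered x y hx hxy
  · rw [abs_sub_comm (g y), abs_sub_comm y]
    exact ordered y x hy hxy

/-- A Potter-type bound for regularly varying functions. -/
theorem exists_potter_bound {α : ℝ} {M : ℝ → ℝ} (hMmeas : Measurable M)
    (hMpos : ∀ s : ℝ, 0 ≤ s → 0 < M s)
    (hreg : ∀ lam : ℝ, 1 ≤ lam →
      Tendsto (fun s : ℝ => M (lam * s) / M s) atTop (𝓝 (lam ^ α))) {δ : ℝ} (hδ : 0 < δ) :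
    ∃ A : ℝ, 1 ≤ A ∧ ∀ s u : ℝ, A ≤ s → 0 < u → A ≤ s * u →
      M s / M (s * u) ≤ Real.exp 2 * (u ^ (δ - α) + u ^ (-δ - α)) := by
  set g : ℝ → ℝ := fun x => Real.log (M (Real.exp x)) - α * x with hg
  have hg_meas : Measurable g := by fun_prop
  have hg_lim : ∀ u : ℝ, 0 ≤ u → Tendsto (fun x => g (x + u) - g x) atTop (𝓝 0) := by
    intro u hu
    have h1 := (hreg (Real.exp u) (Real.one_le_exp hu)).comp Real.tendsto_exp_atTop
    have h2 := (h1.log (Real.rpow_pos_of_pos (Real.exp_pos u) α).ne').sub_const (α * u)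
    rw [Real.log_rpow (Real.exp_pos u), Real.log_exp, sub_self] at h2
    refine h2.congr fun x => ?_
    simp only [hg, Function.comp]
    rw [Real.log_div (hMpos _ (by positivity)).ne' (hMpos _ (by positivity)).ne', add_comm x u,
      Real.exp_add]
    ring
  obtain ⟨X, hX⟩ := eventually_abs_sub_le_linear hg_meas hg_lim hδ
  refine ⟨max 1 (Real.exp X), le_max_left _ _, fun s u hs hu hsu => ?_⟩
  have hs0 : 0 < s := lt_of_lt_of_le one_pos ((le_max_left _ _).trans hs)
  have hsu0 : 0 < s * u := mul_pos hs0 hu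
  have hMs := hMpos s hs0.le
  have hMsu := hMpos (s * u) hsu0.le
  have h1 := hX (Real.log (s * u)) (Real.log s)
    ((Real.le_log_iff_exp_le hsu0).2 ((le_max_right _ _).trans hsu))
    ((Real.le_log_iff_exp_le hs0).2 ((le_max_right _ _).trans hs))
  simp only [hg, Real.exp_log hs0, Real.exp_log hsu0] at h1
  rw [Real.log_mul hs0.ne' hu.ne'] at h1
  have h2 : Real.log s - (Real.log s + Real.log u) = - Real.log u := by ring
  rw [h2, abs_neg] at h1
  have h3 := (le_abs_self _).trans h1
  have h4 : M s / M (s * u) = Real.exp (Real.log (M s) - Real.log (M (s * u))) := by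
    rw [Real.exp_sub, Real.exp_log hMs, Real.exp_log hMsu]
  rw [h4, Real.rpow_def_of_pos hu, Real.rpow_def_of_pos hu, mul_add, ← Real.exp_add,
    ← Real.exp_add]
  rcases abs_cases (Real.log u) with ⟨h, _⟩ | ⟨h, _⟩ <;> rw [h] at h3
  · refine (Real.exp_le_exp.2 ?_).trans (le_add_of_nonneg_right (Real.exp_pos _).le)
    linarith
  · refine (Real.exp_le_exp.2 ?_).trans (le_add_of_nonneg_left (Real.exp_pos _).le)
    linarith

/-- Pointwise convergence of reciprocal ratios of a regularly varying function, for all positive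
dilations. -/
theorem tendsto_div_comp_mul {α : ℝ} {M : ℝ → ℝ}
    (hreg : ∀ lam : ℝ, 1 ≤ lam →
      Tendsto (fun s : ℝ => M (lam * s) / M s) atTop (𝓝 (lam ^ α))) {u : ℝ} (hu : 0 < u) :
    Tendsto (fun s : ℝ => M s / M (s * u)) atTop (𝓝 (u ^ (-α))) := by
  rcases le_total 1 u with h | h
  · have := (hreg u h).inv₀ (Real.rpow_pos_of_pos hu α).ne'
    rw [← Real.rpow_neg hu.le] at this
    refine this.congr fun s => ?_
    rw [inv_div, mul_comm]
  · have h1 := (hreg u⁻¹ ((one_le_inv₀ hu).2 h)).comp (tendsto_id.atTop_mul_const hu)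
    rw [Real.inv_rpow hu.le, ← Real.rpow_neg hu.le] at h1
    refine h1.congr fun s => ?_
    simp only [Function.comp, id]
    congr 2
    field_simp

theorem integrableOn_rpow_mul_div_sq_add_one {a : ℝ} (ha₀ : -2 < a) (ha₁ : a < 0) :
    IntegrableOn (fun u : ℝ => u / (u ^ 2 + 1) * u ^ a) (Set.Ioi 0) := by
  have hmeas : Measurable (fun u : ℝ => u / (u ^ 2 + 1) * u ^ a) := by fun_prop
  rw [← Set.Ioc_union_Ioi_eq_Ioi (zero_le_one' ℝ)]
  refine IntegrableOn.union ?_ ?_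
  · have h : IntegrableOn (fun u : ℝ => u ^ (a + 1)) (Set.Ioc 0 1) :=
      (intervalIntegrable_iff_integrableOn_Ioc_of_le zero_le_one).1
        (intervalIntegral.intervalIntegrable_rpow' (by linarith))
    refine Integrable.mono' h hmeas.aestronglyMeasurable
      ((ae_restrict_iff' measurableSet_Ioc).2 (Eventually.of_forall fun u hu => ?_))
    have hu0 : 0 < u := hu.1
    rw [Real.norm_of_nonneg (by positivity), Real.rpow_add_one hu0.ne', mul_comm]
    gcongr
    exact div_le_self hu0.le (by nlinarith)
  · have h : IntegrableOn (fun u : ℝ => u ^ (a - 1)) (Set.Ioi 1) :=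
      integrableOn_Ioi_rpow_of_lt (by linarith) one_pos
    refine Integrable.mono' h hmeas.aestronglyMeasurable
      ((ae_restrict_iff' measurableSet_Ioi).2 (Eventually.of_forall fun u hu => ?_))
    have hu0 : 0 < u := one_pos.trans hu
    have hle : u / (u ^ 2 + 1) ≤ u⁻¹ := by
      rw [div_le_iff₀ (by positivity)]
      field_simp
      linarith
    rw [Real.norm_of_nonneg (by positivity), Real.rpow_sub_one hu0.ne', mul_comm, div_eq_mul_inv]
    exact mul_le_mul_of_nonneg_left hle (by positivity)

/-- If `ν` is carried by `(0, ∞)` and integrates `τ⁻¹`, its Laplace transform is integrable on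
the half-line. -/
theorem integrableOn_laplace_of_integrable_inv {ν : Measure ℝ} [SFinite ν]
    (hpos : ∀ᵐ τ ∂ν, 0 < τ) (hinv : Integrable (fun τ : ℝ => τ⁻¹) ν) :
    IntegrableOn (fun t : ℝ => ∫ τ, Real.exp (-(τ * t)) ∂ν) (Set.Ici 0) := by
  rw [integrableOn_Ici_iff_integrableOn_Ioi]
  have hcont : Continuous (fun z : ℝ × ℝ => Real.exp (-(z.1 * z.2))) := by fun_prop
  have hprod : Integrable (fun z : ℝ × ℝ => Real.exp (-(z.1 * z.2)))
      (ν.prod (volume.restrict (Set.Ioi 0))) := by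
    rw [integrable_prod_iff hcont.aestronglyMeasurable]
    constructor
    · filter_upwards [hpos] with τ hτ
      have := exp_neg_integrableOn_Ioi 0 hτ
      simpa only [IntegrableOn, neg_mul] using this
    · refine hinv.congr ?_
      filter_upwards [hpos] with τ hτ
      have := integral_exp_mul_Ioi (neg_lt_zero.2 hτ) 0
      simp only [Real.norm_eq_abs, Real.abs_exp]
      simpa [neg_mul] using this.symm
  exact hprod.integral_prod_right

/-- The Abelian asymptotics of the Stieltjes-type transform of a truncated reciprocal of a
regularly varying function. -/
theorem tendsto_mul_integral_div_sq_add_sq {α : ℝ} {M : ℝ → ℝ} (hMmeas : Measurable M)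
    (hMpos : ∀ s : ℝ, 0 ≤ s → 0 < M s)
    (hreg : ∀ lam : ℝ, 1 ≤ lam →
      Tendsto (fun s : ℝ => M (lam * s) / M s) atTop (𝓝 (lam ^ α)))
    {A δ C : ℝ} (hA : 1 ≤ A) (hδ₀ : 0 < δ) (hδ₁ : δ < α) (hδ₂ : α + δ < 2)
    (hpot : ∀ s u : ℝ, A ≤ s → 0 < u → A ≤ s * u →
      M s / M (s * u) ≤ C * (u ^ (δ - α) + u ^ (-δ - α))) :
    Tendsto
      (fun s : ℝ => M s * ∫ τ, τ / (τ ^ 2 + s ^ 2) * (Set.Ici A).indicator (fun τ => (M τ)⁻¹) τ)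
      atTop (𝓝 (∫ u in Set.Ioi (0 : ℝ), u / (u ^ 2 + 1) * u ^ (-α))) := by
  set p : ℝ → ℝ := (Set.Ici A).indicator (fun τ => (M τ)⁻¹) with hp
  have hp_meas : Measurable p := hMmeas.inv.indicator measurableSet_Ici
  have hA0 : 0 < A := one_pos.trans_le hA
  have hscale : ∀ s : ℝ, 0 < s → (∫ u in Set.Ioi (0 : ℝ), u / (u ^ 2 + 1) * (M s * p (s * u))) =
      M s * ∫ τ, τ / (τ ^ 2 + s ^ 2) * p τ := by
    intro s hs
    have h1 := Measure.integral_comp_mul_left (fun τ => τ / (τ ^ 2 + s ^ 2) * p τ) s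
    have h2 : (∫ τ, τ / (τ ^ 2 + s ^ 2) * p τ) =
        s * ∫ u, s * u / ((s * u) ^ 2 + s ^ 2) * p (s * u) := by
      rw [h1, abs_of_pos (inv_pos.2 hs), smul_eq_mul, mul_inv_cancel_left₀ hs.ne']
    rw [h2, ← integral_const_mul, ← integral_const_mul,
      setIntegral_eq_integral_of_forall_compl_eq_zero]
    · refine integral_congr_ae (Eventually.of_forall fun u => ?_)
      have : u ^ 2 + 1 ≠ 0 := by positivity
      have : (s * u) ^ 2 + s ^ 2 = s ^ 2 * (u ^ 2 + 1) := by ring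
      simp only [this]
      field_simp
    · intro u hu
      have hu' : s * u < A := (mul_nonpos_of_nonneg_of_nonpos hs.le (not_lt.1 hu)).trans_lt hA0
      simp [hp, hu']
  refine Tendsto.congr' ((eventually_gt_atTop 0).mono hscale) ?_
  refine tendsto_integral_filter_of_dominated_convergence
    (fun u => C * (u / (u ^ 2 + 1) * u ^ (δ - α) + u / (u ^ 2 + 1) * u ^ (-δ - α))) ?_ ?_ ?_ ?_
  · exact Eventually.of_forall fun s => Measurable.aestronglyMeasurable (by fun_prop)
  · filter_upwards [eventually_ge_atTop A] with s hs
    refine (ae_restrict_iff' measurableSet_Ioi).2 (Eventually.of_forall fun u hu => ?_)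
    have hu0 : 0 < u := hu
    have hs0 : 0 < s := hA0.trans_le hs
    have hMs := hMpos s hs0.le
    have hC : 0 ≤ C := by
      have h := hpot s 1 hs one_pos (by simpa using hs)
      rw [mul_one, div_self hMs.ne'] at h
      norm_num at h
      linarith
    have hpb : 0 ≤ M s * p (s * u) ∧
        M s * p (s * u) ≤ C * (u ^ (δ - α) + u ^ (-δ - α)) := by
      by_cases h : A ≤ s * u
      · have hpe : p (s * u) = (M (s * u))⁻¹ := Set.indicator_of_mem h _
        have := hMpos (s * u) (by positivity)
        rw [hpe]
        exact ⟨by positivity, by simpa [div_eq_mul_inv] using hpot s u hs hu0 h⟩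
      · have hpe : p (s * u) = 0 := Set.indicator_of_notMem h _
        rw [hpe, mul_zero]
        exact ⟨le_rfl, by positivity⟩
    rw [Real.norm_of_nonneg (mul_nonneg (by positivity) hpb.1), ← mul_add,
      mul_left_comm C]
    exact mul_le_mul_of_nonneg_left hpb.2 (by positivity)
  · exact ((integrableOn_rpow_mul_div_sq_add_one (by linarith) (by linarith)).add
      (integrableOn_rpow_mul_div_sq_add_one (by linarith) (by linarith))).const_mul C
  · refine (ae_restrict_iff' measurableSet_Ioi).2 (Eventually.of_forall fun u hu => ?_)
    refine ((tendsto_div_comp_mul hreg hu).congr' ?_).const_mul _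
    filter_upwards [(tendsto_id.atTop_mul_const (show (0 : ℝ) < u from hu)).eventually_ge_atTop A]
      with s hs
    have hpe : p (s * u) = (M (s * u))⁻¹ := Set.indicator_of_mem hs _
    rw [hpe, div_eq_mul_inv]

/-- Let `α ∈ (0,2)` and let `M : [0,∞) → (0,∞)` be measurable and
regularly varying of index `α`. Then there exists a positive Radon measure `ν` on `[0,∞)`
with `ν [0,1) = 0` and `∫ τ⁻¹ dν < ∞` such that `k(t) = ∫ e^{-τ t} dν(τ)` is integrable on
`[0,∞)` and `Re 𝓕k (s) = ∫ τ / (τ² + s²) dν(τ) ∼ 1 / M s` as `s → ∞`, i.e.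
`M s · ∫ τ / (τ² + s²) dν(τ) → 1` as `s → ∞`. -/
theorem statement19 (α : ℝ) (hα : α ∈ Set.Ioo (0 : ℝ) 2)
    (M : ℝ → ℝ) (hMmeas : Measurable M)
    (hMpos : ∀ s : ℝ, 0 ≤ s → 0 < M s)
    (hreg : ∀ lam : ℝ, 1 ≤ lam →
      Tendsto (fun s : ℝ => M (lam * s) / M s) atTop (𝓝 (lam ^ α))) :
    ∃ ν : Measure ℝ, IsLocallyFiniteMeasure ν ∧
      ν (Set.Iio (1 : ℝ)) = 0 ∧
      (∫⁻ τ in Set.Ioi (0 : ℝ), ENNReal.ofReal τ⁻¹ ∂ν) < ⊤ ∧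
      IntegrableOn (fun t : ℝ => ∫ τ, Real.exp (-(τ * t)) ∂ν) (Set.Ici (0 : ℝ)) ∧
      Tendsto (fun s : ℝ => M s * ∫ τ, τ / (τ ^ 2 + s ^ 2) ∂ν) atTop (𝓝 1) := by
  obtain ⟨δ, hδ₀, hδ₁, hδ₂⟩ : ∃ δ : ℝ, 0 < δ ∧ δ < α ∧ α + δ < 2 := by
    refine ⟨min α (2 - α) / 2, ?_, ?_, ?_⟩
    · have := lt_min hα.1 (sub_pos.2 hα.2)
      linarith
    · linarith [min_le_left α (2 - α), hα.1]
    · linarith [min_le_right α (2 - α), hα.2]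
  obtain ⟨A, hA, hpot⟩ := exists_potter_bound hMmeas hMpos hreg hδ₀
  have hA0 : 0 < A := one_pos.trans_le hA
  have hlim := tendsto_mul_integral_div_sq_add_sq hMmeas hMpos hreg hA hδ₀ hδ₁ hδ₂ hpot
  set I : ℝ := ∫ u in Set.Ioi (0 : ℝ), u / (u ^ 2 + 1) * u ^ (-α) with hI
  have hIpos : 0 < I := by
    refine (setIntegral_pos_iff_support_of_nonneg_ae ?_
      (integrableOn_rpow_mul_div_sq_add_one (by linarith [hα.2]) (by linarith [hα.1]))).2 ?_
    · refine (ae_restrict_iff' measurableSet_Ioi).2 (Eventually.of_forall fun u hu => ?_)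
      have hu0 : 0 < u := hu
      simp only [Pi.zero_apply]
      positivity
    · have hsub : Set.Ioi (0 : ℝ) ⊆
          Function.support (fun u : ℝ => u / (u ^ 2 + 1) * u ^ (-α)) ∩ Set.Ioi 0 := by
        intro u hu
        have hu0 : 0 < u := hu
        refine ⟨?_, hu⟩
        rw [Function.mem_support]
        positivity
      exact lt_of_lt_of_le (by simp) (measure_mono hsub)
  set p : ℝ → ℝ := (Set.Ici A).indicator (fun τ => (M τ)⁻¹) with hp
  have hp_meas : Measurable p := hMmeas.inv.indicator measurableSet_Ici
  have hp_out : ∀ τ, τ < A → p τ = 0 := fun τ hτ => Set.indicator_of_notMem (not_le.2 hτ) _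
  have hp0 : ∀ τ, 0 ≤ p τ := fun τ => Set.indicator_nonneg
    (fun t ht => (inv_pos.2 (hMpos t (hA0.le.trans ht))).le) τ
  obtain ⟨K, hK0, hK⟩ : ∃ K : ℝ, 0 ≤ K ∧ ∀ τ, A ≤ τ → p τ ≤ K * τ ^ (δ - α) := by
    have hMA := hMpos A hA0.le
    refine ⟨Real.exp 2 * 2 / M A / A ^ (δ - α), by positivity, fun τ hτ => ?_⟩
    have hτ0 : 0 < τ := hA0.trans_le hτ
    have hMτ := hMpos τ hτ0.le
    have hmul : A * (τ / A) = τ := mul_div_cancel₀ τ hA0.ne'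
    have h1 := hpot A (τ / A) le_rfl (by positivity) (by rwa [hmul])
    have h2 : (τ / A) ^ (-δ - α) ≤ (τ / A) ^ (δ - α) :=
      Real.rpow_le_rpow_of_exponent_le ((one_le_div hA0).2 hτ) (by linarith)
    have hpe : p τ = (M τ)⁻¹ := Set.indicator_of_mem hτ _
    rw [hmul] at h1
    calc p τ = M A / M τ / M A := by rw [hpe]; field_simp
      _ ≤ Real.exp 2 * (2 * (τ / A) ^ (δ - α)) / M A := by
        gcongr
        exact h1.trans (by gcongr; linarith)
      _ = Real.exp 2 * 2 / M A / A ^ (δ - α) * τ ^ (δ - α) := by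
        rw [Real.div_rpow hτ0.le hA0.le]
        ring
  set q : ℝ → ℝ := fun τ => I⁻¹ * p τ with hq
  have hq_meas : Measurable q := hp_meas.const_mul _
  have hq0 : ∀ τ, 0 ≤ q τ := fun τ => mul_nonneg (inv_pos.2 hIpos).le (hp0 τ)
  have hq_le : ∀ τ, q τ ≤ I⁻¹ * K := by
    intro τ
    refine mul_le_mul_of_nonneg_left ?_ (inv_pos.2 hIpos).le
    rcases lt_or_ge τ A with h | h
    · rwa [hp_out τ h]
    · exact (hK τ h).trans (mul_le_of_le_one_right hK0
        (Real.rpow_le_one_of_one_le_of_nonpos (hA.trans h) (by linarith)))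
  set ν : Measure ℝ := volume.withDensity (fun τ => ENNReal.ofReal (q τ)) with hν
  have hν_Iio : ν (Set.Iio A) = 0 := by
    rw [hν, withDensity_apply _ measurableSet_Iio, setLIntegral_congr_fun measurableSet_Iio
      (g := fun _ => 0) (fun τ hτ => by simp [hq, hp_out τ hτ])]
    simp
  have hν_pos : ∀ᵐ τ ∂ν, 0 < τ := by
    refine measure_mono_null (fun τ hτ => ?_) hν_Iio
    have hτ' : τ ≤ 0 := not_lt.1 hτ
    exact hτ'.trans_lt hA0
  have hν_int : ∀ f : ℝ → ℝ, ∫ τ, f τ ∂ν = ∫ τ, q τ * f τ := by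
    intro f
    rw [hν, integral_withDensity_eq_integral_toReal_smul hq_meas.ennreal_ofReal
      (Eventually.of_forall fun _ => ENNReal.ofReal_lt_top)]
    simp [ENNReal.toReal_ofReal, hq0]
  have hinv : Integrable (fun τ : ℝ => τ⁻¹) ν := by
    rw [hν, integrable_withDensity_iff_integrable_smul' hq_meas.ennreal_ofReal
      (Eventually.of_forall fun _ => ENNReal.ofReal_lt_top)]
    simp only [ENNReal.toReal_ofReal (hq0 _), smul_eq_mul]
    rw [← integrableOn_iff_integrable_of_support_subset (s := Set.Ici A),
      integrableOn_Ici_iff_integrableOn_Ioi]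
    · refine Integrable.mono' ((integrableOn_Ioi_rpow_of_lt (a := δ - α - 1) (by linarith)
        hA0).const_mul (I⁻¹ * K)) (hq_meas.mul measurable_inv).aestronglyMeasurable
        ((ae_restrict_iff' measurableSet_Ioi).2 (Eventually.of_forall fun τ hτ => ?_))
      have hτ0 : 0 < τ := hA0.trans hτ
      have hqτ := hq0 τ
      rw [Real.norm_of_nonneg (by positivity), Real.rpow_sub_one hτ0.ne', div_eq_mul_inv,
        ← mul_assoc, mul_assoc I⁻¹ K]
      gcongr
      exact mul_le_mul_of_nonneg_left (hK τ (le_of_lt hτ)) (inv_pos.2 hIpos).le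
    · intro τ hτ
      by_contra h
      exact hτ (by simp [hq, hp_out τ (not_le.1 h)])
  refine ⟨ν, ?_, measure_mono_null (Set.Iio_subset_Iio hA) hν_Iio, ?_,
    integrableOn_laplace_of_integrable_inv hν_pos hinv, ?_⟩
  · have hle : ν ≤ ENNReal.ofReal (I⁻¹ * K) • volume := by
      rw [← withDensity_const]
      exact withDensity_mono (Eventually.of_forall fun τ => ENNReal.ofReal_le_ofReal (hq_le τ))
    have := IsFiniteMeasureOnCompacts.smul (volume : Measure ℝ)
      (ENNReal.ofReal_ne_top (r := I⁻¹ * K))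
    have : IsLocallyFiniteMeasure (ENNReal.ofReal (I⁻¹ * K) • (volume : Measure ℝ)) :=
      isLocallyFiniteMeasure_of_isFiniteMeasureOnCompacts
    exact Measure.isLocallyFiniteMeasure_of_le hle
  · refine (setLIntegral_le_lintegral _ _).trans_lt ?_
    refine (lintegral_mono fun τ => ?_).trans_lt hinv.2
    rw [← ofReal_norm]
    exact ENNReal.ofReal_le_ofReal (Real.le_norm_self _)
  · have h := hlim.const_mul I⁻¹
    rw [inv_mul_cancel₀ hIpos.ne'] at h
    refine h.congr fun s => ?_
    rw [hν_int, mul_left_comm, ← integral_const_mul]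
    congr 2 with τ
    simp only [hq]
    ring
end
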